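/- For the move Ω_{III+−+m} on Gauss diagrams of two-component link diagrams, ⟨foneC, D_l^{Ω_{III+−+m}}⟩ = ⟨foneC, D_r^{Ω_{III+−+m}}⟩ and ⟨foneD, D_l^{Ω_{III+−+m}}⟩ = ⟨foneD, D_r^{Ω_{III+−+m}}⟩, where D_l^{Ω_{III+−+m}} and D_r^{Ω_{III+−+m}} are the two sides of the move; indeed no sub-Gauss diagram containing at least two of the three relocated arrows matches foneC or foneD. -/

import Mathlib

/-!
A combinatorial model of (signed, oriented) Gauss diagrams of two-component
link diagrams, following Ito–Oyamaguchi (arXiv:2006.03861), Polyak–Viro and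
Östlund.

An endpoint is a pair `(a, b)` where `a : ℕ` is the name of an arrow and
`b : Bool` records whether the endpoint is the head (`true`) or the tail
(`false`) of the arrow.  A raw Gauss diagram consists of a finite set of
arrows, a sign (`true` = `+`) for each arrow, and the two cyclically ordered
lists of endpoints on the two circles (each circle oriented counterclockwise,
the list being read along the orientation).  Combinatorial Gauss diagrams are
raw Gauss diagrams up to renaming of the arrows and rotation of the two lists.
-/

namespace GaussD

abbrev Endpoint := ℕ × Bool

structure RawGD where
  arrows : Finset ℕ
  sign : ℕ → Bool
  ends1 : List Endpoint
  ends2 : List Endpoint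

/-- Well-formedness: the endpoints occurring on the two circles are exactly
the head and the tail of each arrow, each occurring exactly once. -/
def WF (G : RawGD) : Prop :=
  (∀ p ∈ G.ends1 ++ G.ends2, p.1 ∈ G.arrows) ∧
  ∀ a ∈ G.arrows, ∀ b : Bool, (G.ends1 ++ G.ends2).count ((a, b) : Endpoint) = 1

def mapEnd (f : ℕ → ℕ) (p : Endpoint) : Endpoint := (f p.1, p.2)

/-- Equality of cyclic lists: `l₂` is a rotation of `l₁`. -/
def rotEq (l₁ l₂ : List Endpoint) : Prop := ∃ k, l₂ = l₁.rotate k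

/-- Two raw Gauss diagrams are equal as combinatorial Gauss diagrams:
there is a renaming of the arrows preserving the signs which matches the
two circles up to rotation (i.e. up to orientation-preserving homeomorphism
of the circles). -/
def GDRel (G H : RawGD) : Prop :=
  ∃ f : ℕ → ℕ, Set.InjOn f (G.arrows : Set ℕ) ∧ G.arrows.image f = H.arrows ∧
    (∀ a ∈ G.arrows, H.sign (f a) = G.sign a) ∧
    rotEq (G.ends1.map (mapEnd f)) H.ends1 ∧
    rotEq (G.ends2.map (mapEnd f)) H.ends2

/-- Combinatorial Gauss diagrams. -/
def GD := Quot GDRel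

def cls (G : RawGD) : GD := Quot.mk _ G

noncomputable instance : DecidableEq GD := Classical.decEq _

/-- Formal ℚ-linear combinations of combinatorial Gauss diagrams. -/
abbrev Pat := GD →₀ ℚ

/-- The sub-Gauss diagram of `G` obtained by keeping exactly the arrows in `S`. -/
def keep (G : RawGD) (S : Finset ℕ) : RawGD where
  arrows := G.arrows ∩ S
  sign := G.sign
  ends1 := G.ends1.filter (fun p => decide (p.1 ∈ S))
  ends2 := G.ends2.filter (fun p => decide (p.1 ∈ S))

def sgn (G : RawGD) (a : ℕ) : ℚ := if G.sign a then 1 else -1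

/-- `sign(z)`: the product of the signs of the arrows of a sub-diagram. -/
def signProd (G : RawGD) (S : Finset ℕ) : ℚ := ∏ a ∈ S, sgn G a

/-- The Gauss diagram pairing `⟨A, G⟩ = Σ_{z ∈ Sub(G)} sign(z)·(A, z)`,
where `(A, ·)` is the orthonormal scalar product extended bilinearly, i.e.
`(A, z)` is the coefficient of the combinatorial class of `z` in `A`. -/
noncomputable def bracket (A : Pat) (G : RawGD) : ℚ :=
  ∑ S ∈ G.arrows.powerset, signProd G S * A (cls (keep G S))

/-! ### Reidemeister moves on Gauss diagrams (Polyak's generating set,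
in Östlund's notation). -/

/-- `x` and `y` are (cyclically) adjacent, in this order, on the circle `l`. -/
def cycAdj (l : List Endpoint) (x y : Endpoint) : Prop := ∃ k u, l.rotate k = x :: y :: u

def adjSomewhere (G : RawGD) (x y : Endpoint) : Prop :=
  cycAdj G.ends1 x y ∨ cycAdj G.ends1 y x ∨ cycAdj G.ends2 x y ∨ cycAdj G.ends2 y x

/-- Insertion of the two endpoints `x`, `y` adjacently into a cyclic list:
`l'` is, up to rotation, `x :: y :: ` (a rotation of `l`). -/
def insAdj (l l' : List Endpoint) (x y : Endpoint) : Prop :=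
  ∃ k j, l'.rotate k = x :: y :: l.rotate j

/-- The first Reidemeister move `Ω_{1 s d}`: `Dl` is obtained from `Dr` by
inserting a single arrow `a` of sign `s` whose two endpoints are adjacent on
one of the circles (`d` records which endpoint comes first). -/
def Omega1At (s d : Bool) (a : ℕ) (Dl Dr : RawGD) : Prop :=
  a ∉ Dr.arrows ∧ Dl.arrows = insert a Dr.arrows ∧
  (∀ b ∈ Dr.arrows, Dl.sign b = Dr.sign b) ∧ Dl.sign a = s ∧
  ((insAdj Dr.ends1 Dl.ends1 (a, d) (a, !d) ∧ rotEq Dr.ends2 Dl.ends2) ∨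
   (insAdj Dr.ends2 Dl.ends2 (a, d) (a, !d) ∧ rotEq Dr.ends1 Dl.ends1))

/-- The second Reidemeister move `Ω_{II+−}` (Polyak's `Ω_{2a}`), with the
inserted pair of arrows named: `Dl` contains two arrows `a`, `b` of signs `+`
and `−`, with adjacent tails and adjacent heads, positioned so that deleting
either one of them yields the same combinatorial Gauss diagram, and `Dr` is
obtained from `Dl` by deleting both. -/
def OmegaIIAt (a b : ℕ) (Dl Dr : RawGD) : Prop :=
  a ≠ b ∧ a ∈ Dl.arrows ∧ b ∈ Dl.arrows ∧
  Dl.sign a = true ∧ Dl.sign b = false ∧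
  adjSomewhere Dl (a, false) (b, false) ∧
  adjSomewhere Dl (a, true) (b, true) ∧
  cls (keep Dl (Dl.arrows.erase a)) = cls (keep Dl (Dl.arrows.erase b)) ∧
  Dr = keep Dl ((Dl.arrows.erase a).erase b)

def OmegaII (Dl Dr : RawGD) : Prop := ∃ a b, OmegaIIAt a b Dl Dr

/-! The third Reidemeister moves `Ω_{III+−+*}` (`* = b, m, t`): the Gauss
diagram versions of the oriented move `Ω_{3a}` with signs `+, −, +`.  Three
pairwise crossing arrows `x` (sign `+`), `y` (sign `−`), `z` (sign `+`) meet
three strands; on each strand two of their six endpoints are adjacent, and the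
move swaps the two endpoints on each of the three strands, keeping all other
arrows fixed.  The strand meeting `x, y` carries their tails; the strand
meeting `x, z` carries the head of `x` and the tail of `z`; the strand meeting
`y, z` carries their heads (as in Östlund's Table 1).  The three variants
`b, m, t` are the three distributions of the strands over the two link
components. -/

def BXl (x y _z : ℕ) : List Endpoint := [(x, false), (y, false)]
def BXr (x y _z : ℕ) : List Endpoint := [(y, false), (x, false)]
def BYl (x _y z : ℕ) : List Endpoint := [(z, false), (x, true)]
def BYr (x _y z : ℕ) : List Endpoint := [(x, true), (z, false)]
def BZl (_x y z : ℕ) : List Endpoint := [(y, true), (z, true)]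
def BZr (_x y z : ℕ) : List Endpoint := [(z, true), (y, true)]

/-- Two of the three strands, with their local blocks `P1`, `P2` (before) and
`Q1`, `Q2` (after), lie on the circle `l` (before) / `l'` (after); the rest of
the circle is unchanged. -/
def twoBlocks (P1 P2 Q1 Q2 l l' : List Endpoint) : Prop :=
  ∃ u v, (∃ k, l.rotate k = P1 ++ u ++ P2 ++ v) ∧ ∃ k, l'.rotate k = Q1 ++ u ++ Q2 ++ v

/-- One strand, with local block `P` (before) / `Q` (after), lies on the
circle `l` (before) / `l'` (after); the rest of the circle is unchanged. -/
def oneBlock (P Q l l' : List Endpoint) : Prop :=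
  ∃ u, (∃ k, l.rotate k = P ++ u) ∧ ∃ k, l'.rotate k = Q ++ u

def OmegaIIICore (x y z : ℕ) (Dl Dr : RawGD) : Prop :=
  x ≠ y ∧ x ≠ z ∧ y ≠ z ∧ x ∈ Dl.arrows ∧ y ∈ Dl.arrows ∧ z ∈ Dl.arrows ∧
  Dr.arrows = Dl.arrows ∧ Dr.sign = Dl.sign ∧
  Dl.sign x = true ∧ Dl.sign y = false ∧ Dl.sign z = true

/-- `Ω_{III+−+b}`: the strand carrying the tails of `x` and `y` is alone on
one component. -/
def OmegaIIIbAt (x y z : ℕ) (Dl Dr : RawGD) : Prop :=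
  OmegaIIICore x y z Dl Dr ∧
  ((twoBlocks (BYl x y z) (BZl x y z) (BYr x y z) (BZr x y z) Dl.ends1 Dr.ends1 ∧
    oneBlock (BXl x y z) (BXr x y z) Dl.ends2 Dr.ends2) ∨
   (twoBlocks (BYl x y z) (BZl x y z) (BYr x y z) (BZr x y z) Dl.ends2 Dr.ends2 ∧
    oneBlock (BXl x y z) (BXr x y z) Dl.ends1 Dr.ends1))

/-- `Ω_{III+−+m}`: the strand carrying the head of `x` and the tail of `z`
is alone on one component. -/
def OmegaIIImAt (x y z : ℕ) (Dl Dr : RawGD) : Prop :=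
  OmegaIIICore x y z Dl Dr ∧
  ((twoBlocks (BXl x y z) (BZl x y z) (BXr x y z) (BZr x y z) Dl.ends1 Dr.ends1 ∧
    oneBlock (BYl x y z) (BYr x y z) Dl.ends2 Dr.ends2) ∨
   (twoBlocks (BXl x y z) (BZl x y z) (BXr x y z) (BZr x y z) Dl.ends2 Dr.ends2 ∧
    oneBlock (BYl x y z) (BYr x y z) Dl.ends1 Dr.ends1))

/-- `Ω_{III+−+t}`: the strand carrying the heads of `y` and `z` is alone on
one component. -/
def OmegaIIItAt (x y z : ℕ) (Dl Dr : RawGD) : Prop :=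
  OmegaIIICore x y z Dl Dr ∧
  ((twoBlocks (BXl x y z) (BYl x y z) (BXr x y z) (BYr x y z) Dl.ends1 Dr.ends1 ∧
    oneBlock (BZl x y z) (BZr x y z) Dl.ends2 Dr.ends2) ∨
   (twoBlocks (BXl x y z) (BYl x y z) (BXr x y z) (BYr x y z) Dl.ends2 Dr.ends2 ∧
    oneBlock (BZl x y z) (BZr x y z) Dl.ends1 Dr.ends1))

/-- Any of the three third moves, with the relocated arrows `x, y, z` named. -/
def OmegaIIIAt (x y z : ℕ) (Dl Dr : RawGD) : Prop :=
  OmegaIIIbAt x y z Dl Dr ∨ OmegaIIImAt x y z Dl Dr ∨ OmegaIIItAt x y z Dl Dr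

def OmegaIII (Dl Dr : RawGD) : Prop := ∃ x y z, OmegaIIIAt x y z Dl Dr

/-- Left-to-right Reidemeister moves of Polyak's generating set
`{Ω_{1−+}, Ω_{1++}, Ω_{II+−}, Ω_{III+−+b}, Ω_{III+−+m}, Ω_{III+−+t}}`. -/
def MoveLR (Dl Dr : RawGD) : Prop :=
  (∃ a, Omega1At false true a Dl Dr) ∨ (∃ a, Omega1At true true a Dl Dr) ∨
  OmegaII Dl Dr ∨ OmegaIII Dl Dr

/-- A single Reidemeister move on Gauss diagrams, in either direction. -/
def Move (D D' : RawGD) : Prop := MoveLR D D' ∨ MoveLR D' D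

/-- Two well-formed Gauss diagrams represent isotopic two-component links iff
they are related by a finite sequence of Reidemeister moves (and combinatorial
equalities). -/
def LinkEquiv (D D' : RawGD) : Prop :=
  Relation.ReflTransGen (fun G H => WF G ∧ WF H ∧ (Move G H ∨ GDRel G H ∨ GDRel H G)) D D'

/-! ### Switching arrows and the Vassiliev condition -/

/-- Switch (reverse the direction and the sign of) every arrow in `S`. -/
def switch (G : RawGD) (S : Finset ℕ) : RawGD where
  arrows := G.arrows
  sign := fun a => if a ∈ S then !G.sign a else G.sign a
  ends1 := G.ends1.map fun p => if p.1 ∈ S then (p.1, !p.2) else p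
  ends2 := G.ends2.map fun p => if p.1 ∈ S then (p.1, !p.2) else p

/-- `⟨A, ·⟩` is a Vassiliev invariant of order (degree) at most three: the
alternating sum over switching any four chosen arrows vanishes. -/
def VassilievLE3 (A : Pat) : Prop :=
  ∀ G : RawGD, WF G → ∀ a b c d : ℕ,
    a ∈ G.arrows → b ∈ G.arrows → c ∈ G.arrows → d ∈ G.arrows →
    a ≠ b → a ≠ c → a ≠ d → b ≠ c → b ≠ d → c ≠ d →
    ∑ S ∈ ({a, b, c, d} : Finset ℕ).powerset,
      (-1 : ℚ) ^ S.card * bracket A (switch G S) = 0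

/-! ### Patterns with unsigned arrows -/

/-- Reassign the signs of the arrows of `G`: the arrows in `T` get `+`,
the others get `−`. -/
def resign (G : RawGD) (T : Finset ℕ) : RawGD :=
  { G with sign := fun a => decide (a ∈ T) }

/-- The pattern with unsigned arrows determined by `G`: the formal sum of the
Gauss diagrams obtained from `G` by assigning signs to its arrows in all
possible ways. -/
noncomputable def unsignedOf (G : RawGD) : Pat :=
  ∑ T ∈ G.arrows.powerset, Finsupp.single (cls (resign G T)) 1

/-- Formal ℚ-linear combinations of patterns with unsigned arrows. -/
noncomputable def UnsignedSpan : Submodule ℚ Pat := Submodule.span ℚ (Set.range unsignedOf)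

/-! ### The specific patterns of Ito–Oyamaguchi (arXiv:2006.03861) -/

/-- The three-arrow raw Gauss diagram with arrows `0, 1, 2` of signs
`s0, s1, s2` and circles `e1`, `e2`. -/
def mkRaw (s0 s1 s2 : Bool) (e1 e2 : List Endpoint) : RawGD where
  arrows := {0, 1, 2}
  sign := fun a => if a = 0 then s0 else if a = 1 then s1 else s2
  ends1 := e1
  ends2 := e2

/-- The sum of the diagrams over all sign assignments (an unsigned pattern). -/
noncomputable def unsignedPat (e1 e2 : List Endpoint) : Pat :=
  ∑ s0 : Bool, ∑ s1 : Bool, ∑ s2 : Bool, Finsupp.single (cls (mkRaw s0 s1 s2 e1 e2)) 1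

/-- The sum of the diagrams over sign assignments with the sign of the
distinguished arrow `0` fixed to `s0` (Notation 3 of Ito–Oyamaguchi). -/
noncomputable def halfPat (s0 : Bool) (e1 e2 : List Endpoint) : Pat :=
  ∑ s1 : Bool, ∑ s2 : Bool, Finsupp.single (cls (mkRaw s0 s1 s2 e1 e2)) 1

/- The underlying arrow configurations of the patterns of Ito–Oyamaguchi
(arXiv:2006.03861) / Östlund's corrected Polyak–Viro degree-three formula. -/
def eA1 : List Endpoint := [(0, false), (2, false), (1, false), (2, true)]
def eA2 : List Endpoint := [(0, true), (1, true)]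
def eB1 : List Endpoint := [(0, false), (1, false)]
def eB2 : List Endpoint := [(0, true), (2, false), (1, true), (2, true)]
def eC1 : List Endpoint := [(0, false), (1, false), (2, false)]
def eC2 : List Endpoint := [(0, true), (2, true), (1, true)]
def eD1 : List Endpoint := [(0, false), (1, false), (2, false)]
def eD2 : List Endpoint := [(0, true), (1, true), (2, true)]

noncomputable def foneA : Pat := unsignedPat eA1 eA2
noncomputable def foneB : Pat := unsignedPat eB1 eB2
noncomputable def foneC : Pat := unsignedPat eC1 eC2
noncomputable def foneD : Pat := unsignedPat eD1 eD2
noncomputable def fonep : Pat := halfPat true eA1 eA2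
noncomputable def fonem : Pat := halfPat false eA1 eA2
noncomputable def ftwop : Pat := halfPat true eB1 eB2
noncomputable def ftwom : Pat := halfPat false eB1 eB2

/-- Östlund's corrected form of the Polyak–Viro degree-three formula:
`T = foneA + foneB + foneC − (1/3)·foneD`. -/
noncomputable def Tpat : Pat := foneA + foneB + foneC - (3⁻¹ : ℚ) • foneD

/-- The two-component link `L(m, n)` of Ito–Oyamaguchi (Figure 5), given by a
Gauss diagram with `m + n + 8` arrows containing a band of `m` parallel
arrows, a band of `n` parallel arrows, and eight further arrows. -/
def Lmn (m n : ℕ) : RawGD where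
  arrows := Finset.range (m + n + 8)
  sign := fun a => decide (a < m + n)
  ends1 := (List.range (m + n + 8)).map fun i => (i, false)
  ends2 := ((List.range (m + n + 8)).reverse).map fun i => (i, true)

/-- All arrows go from the first circle to the second one. -/
def AllDown (G : RawGD) : Prop :=
  (∀ p ∈ G.ends1, p.2 = false) ∧ ∀ p ∈ G.ends2, p.2 = true

theorem forall_snd_iff_of_rotEq {f : ℕ → ℕ} {l l' : List Endpoint}
    (h : rotEq (l.map (mapEnd f)) l') (b : Bool) :
    (∀ p ∈ l, p.2 = b) ↔ ∀ p ∈ l', p.2 = b := by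
  obtain ⟨k, rfl⟩ := h
  simp only [List.mem_rotate, List.forall_mem_map, mapEnd]

theorem GDRel.allDown_iff {G H : RawGD} (h : GDRel G H) : AllDown G ↔ AllDown H := by
  obtain ⟨f, -, -, -, h1, h2⟩ := h
  exact and_congr (forall_snd_iff_of_rotEq h1 false) (forall_snd_iff_of_rotEq h2 true)

theorem allDown_iff_of_cls_eq {G H : RawGD} (h : cls G = cls H) : AllDown G ↔ AllDown H :=
  iff_of_eq (congrArg (Quot.lift AllDown fun _ _ r => propext r.allDown_iff) h)

theorem unsignedPat_cls_eq_zero {e1 e2 : List Endpoint} (h1 : ∀ p ∈ e1, p.2 = false)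
    (h2 : ∀ p ∈ e2, p.2 = true) {G : RawGD} (hG : ¬ AllDown G) :
    unsignedPat e1 e2 (cls G) = 0 := by
  have h : ∀ s0 s1 s2, cls (mkRaw s0 s1 s2 e1 e2) ≠ cls G := fun s0 s1 s2 hc =>
    hG ((allDown_iff_of_cls_eq hc).1 ⟨h1, h2⟩)
  simp [unsignedPat, h]

theorem foneC_foneD_cls_eq_zero {G : RawGD} (hG : ¬ AllDown G) :
    foneC (cls G) = 0 ∧ foneD (cls G) = 0 :=
  ⟨unsignedPat_cls_eq_zero (by decide) (by decide) hG,
    unsignedPat_cls_eq_zero (by decide) (by decide) hG⟩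

theorem not_allDown_keep_of_head {G : RawGD} {S : Finset ℕ} {a : ℕ} (ha : a ∈ S)
    (h : ((a, true) : Endpoint) ∈ G.ends1) : ¬ AllDown (keep G S) := fun hd =>
  Bool.noConfusion (hd.1 (a, true) (List.mem_filter.2 ⟨h, decide_eq_true ha⟩))

theorem not_allDown_keep_of_tail {G : RawGD} {S : Finset ℕ} {a : ℕ} (ha : a ∈ S)
    (h : ((a, false) : Endpoint) ∈ G.ends2) : ¬ AllDown (keep G S) := fun hd =>
  Bool.noConfusion (hd.2 (a, false) (List.mem_filter.2 ⟨h, decide_eq_true ha⟩))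

theorem isRotated_filter {α : Type*} (p : α → Bool) {l l' : List α} (h : l ~r l') :
    l.filter p ~r l'.filter p := by
  obtain ⟨k, hk, rfl⟩ := List.isRotated_iff_mod.1 h
  rw [List.rotate_eq_drop_append_take hk, List.filter_append]
  conv_lhs => rw [← List.take_append_drop k l, List.filter_append]
  exact List.isRotated_append

theorem twoBlocks.filter_isRotated {P1 P2 Q1 Q2 l l' : List Endpoint}
    (h : twoBlocks P1 P2 Q1 Q2 l l') (p : Endpoint → Bool)
    (h1 : P1.filter p = Q1.filter p) (h2 : P2.filter p = Q2.filter p) :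
    l.filter p ~r l'.filter p := by
  obtain ⟨u, v, hl, hl'⟩ := h
  have e : (P1 ++ u ++ P2 ++ v).filter p = (Q1 ++ u ++ Q2 ++ v).filter p := by
    simp only [List.filter_append, h1, h2]
  exact (isRotated_filter p hl).trans (e ▸ (isRotated_filter p hl').symm)

theorem oneBlock.filter_isRotated {P Q l l' : List Endpoint} (h : oneBlock P Q l l')
    (p : Endpoint → Bool) (h1 : P.filter p = Q.filter p) : l.filter p ~r l'.filter p := by
  obtain ⟨u, hl, hl'⟩ := h
  have e : (P ++ u).filter p = (Q ++ u).filter p := by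
    simp only [List.filter_append, h1]
  exact (isRotated_filter p hl).trans (e ▸ (isRotated_filter p hl').symm)

theorem twoBlocks.block_subset {P1 P2 Q1 Q2 l l' : List Endpoint}
    (h : twoBlocks P1 P2 Q1 Q2 l l') :
    (∀ q ∈ P1 ++ P2, q ∈ l) ∧ ∀ q ∈ Q1 ++ Q2, q ∈ l' := by
  obtain ⟨u, v, ⟨k, hk⟩, k', hk'⟩ := h
  constructor <;> intro q hq
  · rw [← List.mem_rotate (n := k), hk]; grind
  · rw [← List.mem_rotate (n := k'), hk']; grind

theorem cls_keep_eq {G H : RawGD} (S : Finset ℕ) (ha : H.arrows = G.arrows)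
    (hs : H.sign = G.sign) (h1 : (keep G S).ends1 ~r (keep H S).ends1)
    (h2 : (keep G S).ends2 ~r (keep H S).ends2) : cls (keep G S) = cls (keep H S) := by
  have hid : mapEnd id = id := rfl
  obtain ⟨j, hj⟩ := h1
  obtain ⟨k, hk⟩ := h2
  refine Quot.sound ⟨id, Set.injOn_id _, ?_, fun a _ => congrFun hs a, ⟨j, ?_⟩, ⟨k, ?_⟩⟩
  · simp [keep, ha]
  · rw [hid, List.map_id, hj]
  · rw [hid, List.map_id, hk]

theorem two_le_card_inter_iff {x y z : ℕ} (hxy : x ≠ y) (hxz : x ≠ z) (hyz : y ≠ z)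
    (S : Finset ℕ) : 2 ≤ (S ∩ {x, y, z}).card ↔
      (x ∈ S ∧ y ∈ S) ∨ (x ∈ S ∧ z ∈ S) ∨ (y ∈ S ∧ z ∈ S) := by
  rw [Finset.inter_comm]
  by_cases hx : x ∈ S <;> by_cases hy : y ∈ S <;> by_cases hz : z ∈ S <;>
    simp [Finset.insert_inter_of_mem, Finset.insert_inter_of_notMem, hx, hy, hz, hxy, hxz, hyz]

theorem filter_pair_comm {S : Finset ℕ} {p q : Endpoint} (h : ¬ (p.1 ∈ S ∧ q.1 ∈ S)) :
    [p, q].filter (fun r => decide (r.1 ∈ S)) = [q, p].filter (fun r => decide (r.1 ∈ S)) := by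
  by_cases hp : p.1 ∈ S <;> by_cases hq : q.1 ∈ S <;> simp_all

/-- The two sides of the move agree after deleting all but at most one of the relocated arrows. -/
theorem OmegaIIImAt.cls_keep_eq {x y z : ℕ} {Dl Dr : RawGD} (h : OmegaIIImAt x y z Dl Dr)
    {S : Finset ℕ} (hxy : ¬ (x ∈ S ∧ y ∈ S)) (hxz : ¬ (x ∈ S ∧ z ∈ S))
    (hyz : ¬ (y ∈ S ∧ z ∈ S)) : cls (keep Dl S) = cls (keep Dr S) := by
  obtain ⟨⟨-, -, -, -, -, -, ha, hs, -⟩, ⟨h1, h2⟩ | ⟨h2, h1⟩⟩ := h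
  · exact GaussD.cls_keep_eq S ha hs
      (h1.filter_isRotated _ (filter_pair_comm hxy) (filter_pair_comm hyz))
      (h2.filter_isRotated _ (filter_pair_comm (mt And.symm hxz)))
  · exact GaussD.cls_keep_eq S ha hs
      (h1.filter_isRotated _ (filter_pair_comm (mt And.symm hxz)))
      (h2.filter_isRotated _ (filter_pair_comm hxy) (filter_pair_comm hyz))

theorem OmegaIIImAt.not_allDown_keep {x y z : ℕ} {Dl Dr : RawGD} (h : OmegaIIImAt x y z Dl Dr)
    {S : Finset ℕ} (hS : (x ∈ S ∧ y ∈ S) ∨ (x ∈ S ∧ z ∈ S) ∨ (y ∈ S ∧ z ∈ S)) :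
    ¬ AllDown (keep Dl S) ∧ ¬ AllDown (keep Dr S) := by
  obtain ⟨-, ⟨h, -⟩ | ⟨h, -⟩⟩ := h
  · obtain ⟨hl, hr⟩ := h.block_subset
    have hS' : y ∈ S ∨ z ∈ S := by tauto
    rcases hS' with hS' | hS' <;>
      exact ⟨not_allDown_keep_of_head hS' (hl _ (by simp [BXl, BZl])),
        not_allDown_keep_of_head hS' (hr _ (by simp [BXr, BZr]))⟩
  · obtain ⟨hl, hr⟩ := h.block_subset
    have hS' : x ∈ S ∨ y ∈ S := by tauto
    rcases hS' with hS' | hS' <;>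
      exact ⟨not_allDown_keep_of_tail hS' (hl _ (by simp [BXl, BZl])),
        not_allDown_keep_of_tail hS' (hr _ (by simp [BXr, BZr]))⟩

theorem bracket_congr {A : Pat} {G H : RawGD} (ha : H.arrows = G.arrows)
    (hs : H.sign = G.sign) (h : ∀ S, A (cls (keep G S)) = A (cls (keep H S))) :
    bracket A G = bracket A H := by
  simp only [bracket, signProd, sgn, ha, hs, h]

/-- `⟨foneC,·⟩` and `⟨foneD,·⟩` are unchanged under the move
`Ω_{III+−+m}`; indeed no sub-Gauss diagram containing at least two of the
three relocated arrows matches `foneC` or `foneD`. -/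
theorem foneC_foneD_invariant_under_omegaIIIm (Dl Dr : RawGD) (x y z : ℕ)
    (hl : WF Dl) (hr : WF Dr) (h : OmegaIIImAt x y z Dl Dr) :
    (bracket foneC Dl = bracket foneC Dr ∧
     bracket foneD Dl = bracket foneD Dr) ∧
    (∀ S ∈ Dl.arrows.powerset, 2 ≤ (S ∩ ({x, y, z} : Finset ℕ)).card →
      foneC (cls (keep Dl S)) = 0 ∧ foneD (cls (keep Dl S)) = 0) ∧
    (∀ S ∈ Dr.arrows.powerset, 2 ≤ (S ∩ ({x, y, z} : Finset ℕ)).card →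
      foneC (cls (keep Dr S)) = 0 ∧ foneD (cls (keep Dr S)) = 0) := by
  have ⟨⟨hxy, hxz, hyz, _, _, _, ha, hs, _⟩, _⟩ := h
  have key : ∀ S : Finset ℕ, 2 ≤ (S ∩ ({x, y, z} : Finset ℕ)).card →
      (foneC (cls (keep Dl S)) = 0 ∧ foneD (cls (keep Dl S)) = 0) ∧
      (foneC (cls (keep Dr S)) = 0 ∧ foneD (cls (keep Dr S)) = 0) := fun S hS =>
    (h.not_allDown_keep ((two_le_card_inter_iff hxy hxz hyz S).1 hS)).imp
      foneC_foneD_cls_eq_zero foneC_foneD_cls_eq_zero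
  have agree : ∀ S : Finset ℕ, foneC (cls (keep Dl S)) = foneC (cls (keep Dr S)) ∧
      foneD (cls (keep Dl S)) = foneD (cls (keep Dr S)) := by
    intro S
    by_cases hS : 2 ≤ (S ∩ ({x, y, z} : Finset ℕ)).card
    · obtain ⟨⟨hCl, hDl⟩, hCr, hDr⟩ := key S hS
      exact ⟨hCl.trans hCr.symm, hDl.trans hDr.symm⟩
    · rw [two_le_card_inter_iff hxy hxz hyz, not_or, not_or] at hS
      rw [h.cls_keep_eq hS.1 hS.2.1 hS.2.2]
      exact ⟨rfl, rfl⟩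
  exact ⟨⟨bracket_congr ha hs fun S => (agree S).1, bracket_congr ha hs fun S => (agree S).2⟩,
    fun S _ hS => (key S hS).1, fun S _ hS => (key S hS).2⟩

end GaussD
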